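/- If G ⊆ ℂ is a Jordan domain, then the set ∂ₛₙG of semi-unreachable boundary points of G is empty. -/

import Mathlib

/-- `J` is a crosscut of `G`: `J = γ((0,1))` for a continuous injective
`γ : [0,1] → ℂ` with `γ((0,1)) ⊆ G` and endpoints `γ 0, γ 1 ∈ ∂G`. -/
def IsCrosscut (G J : Set ℂ) : Prop :=
  ∃ γ : ℝ → ℂ, ContinuousOn γ (Set.Icc 0 1) ∧ Set.InjOn γ (Set.Icc 0 1) ∧
    J = γ '' Set.Ioo 0 1 ∧ J ⊆ G ∧ γ 0 ∈ frontier G ∧ γ 1 ∈ frontier G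

/-- The set `∂ₐG` of accessible boundary points of `G`. -/
def accessiblePts (G : Set ℂ) : Set ℂ :=
  {a | a ∈ frontier G ∧ ∃ γ : ℝ → ℂ, ContinuousOn γ (Set.Icc 0 1) ∧
    Set.InjOn γ (Set.Icc 0 1) ∧ γ '' Set.Ico 0 1 ⊆ G ∧ γ 1 = a}

/-- The set `∂ₙG = ∂G \ ∂ₐG` of non-accessible boundary points of `G`. -/
def nonAccessiblePts (G : Set ℂ) : Set ℂ := frontier G \ accessiblePts G

/-- The set `∂ₛₙG` of semi-unreachable boundary points of `G`. -/
def semiUnreachablePts (G : Set ℂ) : Set ℂ :=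
  {a | a ∈ frontier G ∧ ∃ J U V : Set ℂ, IsCrosscut G J ∧
    IsOpen U ∧ IsOpen V ∧ IsConnected U ∧ IsConnected V ∧ Disjoint U V ∧
    G \ J = U ∪ V ∧ a ∈ (nonAccessiblePts U ∪ nonAccessiblePts V) \ J}

/-- `Γ` is a Jordan curve: the image of an injective continuous map
from the unit circle into `ℂ`. -/
def IsJordanCurve (Γ : Set ℂ) : Prop :=
  ∃ f : ℂ → ℂ, ContinuousOn f (Metric.sphere (0 : ℂ) 1) ∧
    Set.InjOn f (Metric.sphere (0 : ℂ) 1) ∧ Γ = f '' Metric.sphere (0 : ℂ) 1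

/-- `G` is a Jordan domain: a bounded nonempty open connected set that is a
connected component of the complement of a Jordan curve `Γ` with `∂G = Γ`. -/
def IsJordanDomain (G : Set ℂ) : Prop :=
  IsOpen G ∧ IsConnected G ∧ Bornology.IsBounded G ∧
    ∃ Γ : Set ℂ, IsJordanCurve Γ ∧ frontier G = Γ ∧
      ∃ z ∈ G, G = connectedComponentIn Γᶜ z

theorem exists_continuousOn_log_ratio {K C : Set ℂ} (hK : IsClosed K) (hC : IsPreconnected C)
    (hd : Disjoint C K) {p q : ℂ} (hp : p ∈ C) (hq : q ∈ C) :
    ∃ L : ℂ → ℂ, ContinuousOn L K ∧ ∀ z ∈ K, Complex.exp (L z) * (z - q) = z - p := by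
  refine hC.induction₂' (fun p q ↦ ∃ L : ℂ → ℂ, ContinuousOn L K ∧
    ∀ z ∈ K, Complex.exp (L z) * (z - q) = z - p) (fun x hx ↦ ?_) ?_ hp hq
  · have hxK : x ∉ K := fun h ↦ hd.le_bot ⟨hx, h⟩
    obtain ⟨r, hr, hrK⟩ := Metric.isOpen_iff.1 hK.isOpen_compl x hxK
    filter_upwards [mem_nhdsWithin_of_mem_nhds (Metric.ball_mem_nhds x hr)] with y hy
    have key : ∀ z ∈ K, z ≠ x ∧ (z - y) / (z - x) ∈ Complex.slitPlane := by
      intro z hz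
      have h1 : r ≤ ‖z - x‖ := by
        by_contra h
        exact hrK (by simpa [dist_eq_norm] using h : z ∈ Metric.ball x r) hz
      have h2 : z - x ≠ 0 := by
        intro h; rw [h, norm_zero] at h1; linarith
      refine ⟨sub_ne_zero.1 h2, ?_⟩
      have h3 : (z - y) / (z - x) = 1 + (x - y) / (z - x) := by field_simp; ring
      rw [h3]
      apply Complex.mem_slitPlane_of_norm_lt_one
      rw [norm_div, div_lt_one (by positivity)]
      rw [Metric.mem_ball, dist_comm, dist_eq_norm] at hy
      linarith
    have hcont : ContinuousOn (fun z ↦ Complex.log ((z - y) / (z - x))) K :=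
      ContinuousOn.clog (ContinuousOn.div (by fun_prop) (by fun_prop)
        fun z hz ↦ sub_ne_zero.2 (key z hz).1) fun z hz ↦ (key z hz).2
    have hexp : ∀ z ∈ K, Complex.exp (Complex.log ((z - y) / (z - x))) * (z - x) = z - y := by
      intro z hz
      rw [Complex.exp_log (Complex.slitPlane_ne_zero (key z hz).2),
        div_mul_cancel₀ _ (sub_ne_zero.2 (key z hz).1)]
    refine ⟨⟨fun z ↦ -Complex.log ((z - y) / (z - x)), hcont.neg, fun z hz ↦ ?_⟩,
      ⟨_, hcont, hexp⟩⟩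
    rw [← hexp z hz, ← mul_assoc, ← Complex.exp_add]
    simp
  · rintro x y z - - - ⟨L, hL, hL'⟩ ⟨M, hM, hM'⟩
    refine ⟨fun z ↦ L z + M z, hL.add hM, fun w hw ↦ ?_⟩
    rw [Complex.exp_add, mul_assoc, hM' w hw, hL' w hw]

theorem eq_of_exp_eq_of_isPreconnected {X : Type*} [TopologicalSpace X] {s : Set X}
    (hs : IsPreconnected s) {f : X → ℂ} (hf : ContinuousOn f s) {c : ℂ}
    (h : ∀ x ∈ s, Complex.exp (f x) = c) {x y : X} (hx : x ∈ s) (hy : y ∈ s) : f x = f y := by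
  have hc : c ≠ 0 := h x hx ▸ Complex.exp_ne_zero _
  have := (Complex.isCoveringMap_exp ⟨c, hc⟩).1
  refine hs.constant_of_mapsTo (T := (fun z : ℂ ↦ (⟨_, z.exp_ne_zero⟩ : {z : ℂ // z ≠ 0})) ⁻¹'
    {⟨c, hc⟩}) ⟨this⟩ hf (fun z hz ↦ Subtype.ext (h z hz)) hx hy

theorem frontier_connectedComponentIn_compl_subset {K : Set ℂ} (hK : IsClosed K) (p : ℂ) :
    frontier (connectedComponentIn Kᶜ p) ⊆ K := by
  intro z hz
  by_contra hzK
  have ho : ∀ w, IsOpen (connectedComponentIn Kᶜ w) := fun w ↦ hK.isOpen_compl.connectedComponentIn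
  obtain ⟨w, hw1, hw2⟩ := mem_closure_iff.1 hz.1 _ (ho z) (mem_connectedComponentIn hzK)
  have h : connectedComponentIn Kᶜ p = connectedComponentIn Kᶜ z :=
    (connectedComponentIn_eq hw2).trans (connectedComponentIn_eq hw1).symm
  rw [(ho p).frontier_eq, h] at hz
  exact hz.2 (mem_connectedComponentIn hzK)

theorem not_forall_ne_zero_of_eq_sub {F : ℂ → ℂ} (hF : Continuous F) {p : ℂ} {R : ℝ}
    (hR : 0 < R) (h : ∀ z, ‖z - p‖ = R → F z = z - p) : ¬ ∀ z, F z ≠ 0 := by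
  intro h0
  obtain ⟨H, ⟨-, hH⟩, -⟩ := Complex.isCoveringMapOn_exp.existsUnique_continuousMap_lifts
    ⟨F, hF⟩ (Complex.exp_log (h0 0)) h0
  replace hH : ∀ z, Complex.exp (H z) = F z := fun z ↦ congrFun hH z
  let f : ℝ → ℂ := fun θ ↦ H (p + R * Complex.exp (θ * Complex.I)) - θ * Complex.I
  have hf : Continuous f := by fun_prop
  have hc : ∀ θ ∈ Set.univ, Complex.exp (f θ) = R := by
    intro θ _
    rw [Complex.exp_sub, hH, h _ (by simp [Complex.norm_exp_ofReal_mul_I, hR.le])]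
    field_simp
    ring
  have := eq_of_exp_eq_of_isPreconnected isPreconnected_univ hf.continuousOn hc
    (Set.mem_univ 0) (Set.mem_univ (2 * Real.pi))
  simp [f, Complex.exp_two_pi_mul_I] at this
  exact Complex.two_pi_I_ne_zero (by linear_combination this)

theorem mem_connectedComponentIn_of_log_ratio {K : Set ℂ} (hK : IsClosed K) {p q : ℂ}
    (hp : p ∉ K) (hb : Bornology.IsBounded (connectedComponentIn Kᶜ p)) {L : ℂ → ℂ}
    (hL : ContinuousOn L K) (hexp : ∀ z ∈ K, Complex.exp (L z) * (z - q) = z - p) :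
    q ∈ connectedComponentIn Kᶜ p := by
  classical
  by_contra hq
  obtain ⟨M, hM⟩ := ContinuousMap.exists_restrict_eq hK ⟨K.domRestrict L, hL.domRestrict⟩
  replace hM : ∀ z ∈ K, M z = L z := fun z hz ↦ congrFun (congrArg DFunLike.coe hM) ⟨z, hz⟩
  set D := connectedComponentIn Kᶜ p with hD
  have hpD : p ∈ D := mem_connectedComponentIn hp
  obtain ⟨R, hR0, hR⟩ := hb.subset_ball_lt 0 p
  refine not_forall_ne_zero_of_eq_sub (p := p) (R := R)
    (F := fun z ↦ if z ∈ D then Complex.exp (M z) * (z - q) else z - p) ?_ hR0 ?_ ?_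
  · refine Continuous.if (fun z hz ↦ ?_) (by fun_prop) (by fun_prop)
    have hz' := frontier_connectedComponentIn_compl_subset hK p hz
    rw [hM z hz', hexp z hz']
  · intro z hz
    have : z ∉ D := fun h ↦ by simpa [dist_eq_norm, hz] using hR h
    simp [this]
  · intro z
    by_cases hz : z ∈ D
    · simp [hz, sub_ne_zero, ne_of_mem_of_not_mem hz hq]
    · simp [hz, sub_ne_zero, (ne_of_mem_of_not_mem hpD hz).symm]

/-- **Janiszewski's theorem**: if neither `A` nor `B` separates `p` from `q` and `A ∩ B` is
preconnected, then `A ∪ B` does not separate `p` from `q`. -/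
theorem mem_connectedComponentIn_compl_union {A B C D : Set ℂ} (hA : IsClosed A) (hB : IsClosed B)
    (hAB : IsPreconnected (A ∩ B)) (hC : IsPreconnected C) (hCA : Disjoint C A)
    (hD : IsPreconnected D) (hDB : Disjoint D B) {p q : ℂ} (hpC : p ∈ C) (hqC : q ∈ C)
    (hpD : p ∈ D) (hqD : q ∈ D) (hb : Bornology.IsBounded (connectedComponentIn (A ∪ B)ᶜ p)) :
    q ∈ connectedComponentIn (A ∪ B)ᶜ p := by
  classical
  obtain ⟨L, hL, hL'⟩ := exists_continuousOn_log_ratio hA hC hCA hpC hqC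
  obtain ⟨M, hM, hM'⟩ := exists_continuousOn_log_ratio hB hD hDB hpD hqD
  have hpA : p ∉ A := Set.disjoint_left.1 hCA hpC
  have hpB : p ∉ B := Set.disjoint_left.1 hDB hpD
  have hqB : q ∉ B := Set.disjoint_left.1 hDB hqD
  have h1 : ∀ z ∈ A ∩ B, Complex.exp (L z - M z) = 1 := by
    intro z hz
    have hzq : z - q ≠ 0 := sub_ne_zero.2 (ne_of_mem_of_not_mem hz.2 hqB)
    rw [Complex.exp_sub, div_eq_one_iff_eq (Complex.exp_ne_zero _)]
    exact mul_right_cancel₀ hzq ((hL' z hz.1).trans (hM' z hz.2).symm)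
  obtain ⟨c, hc1, hc⟩ : ∃ c : ℂ, Complex.exp c = 1 ∧ ∀ z ∈ A ∩ B, L z = M z + c := by
    rcases (A ∩ B).eq_empty_or_nonempty with h | ⟨w, hw⟩
    · exact ⟨0, by simp, by simp [h]⟩
    · refine ⟨L w - M w, h1 w hw, fun z hz ↦ ?_⟩
      rw [← eq_of_exp_eq_of_isPreconnected hAB (f := fun z ↦ L z - M z)
        ((hL.mono Set.inter_subset_left).sub (hM.mono Set.inter_subset_right)) h1 hz hw]
      ring
  refine mem_connectedComponentIn_of_log_ratio (hA.union hB) (by simp [hpA, hpB]) hb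
    (L := fun z ↦ if z ∈ A then L z else M z + c)
    (ContinuousOn.union_of_isClosed ?_ ?_ hA hB) ?_
  · exact hL.congr fun z hz ↦ if_pos hz
  · refine (hM.add (continuousOn_const (c := c))).congr fun z hz ↦ ?_
    by_cases hzA : z ∈ A
    · simp [hzA, hc z ⟨hzA, hz⟩]
    · simp [hzA]
  · intro z hz
    by_cases hzA : z ∈ A
    · simp [hzA, hL' z hzA]
    · simp [hzA, Complex.exp_add, hc1, hM' z (hz.resolve_left hzA)]

section

open Set

theorem exists_gap {K : Set ℝ} (hK : IsClosed K) {a b x y : ℝ} (ha : a ∈ K) (hb : b ∈ K)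
    (hax : a ≤ x) (hxy : x ≤ y) (hyb : y ≤ b) (hd : Disjoint K (Icc x y)) :
    ∃ s ∈ K, ∃ t ∈ K, a ≤ s ∧ s < x ∧ y < t ∧ t ≤ b ∧ Disjoint K (Ioo s t) := by
  have hs := (hK.inter isClosed_Icc).csSup_mem (s := K ∩ Icc a x) ⟨a, ha, le_rfl, hax⟩
    (bddAbove_Icc.mono inter_subset_right)
  have ht := (hK.inter isClosed_Icc).csInf_mem (s := K ∩ Icc y b) ⟨b, hb, hyb, le_rfl⟩
    (bddBelow_Icc.mono inter_subset_right)
  have hsx : sSup (K ∩ Icc a x) ≠ x := fun h ↦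
    Set.disjoint_left.1 hd (h ▸ hs.1) ⟨le_rfl, hxy⟩
  have hty : y ≠ sInf (K ∩ Icc y b) := fun h ↦
    Set.disjoint_left.1 hd (h ▸ ht.1 : y ∈ K) ⟨hxy, le_rfl⟩
  refine ⟨_, hs.1, _, ht.1, hs.2.1, lt_of_le_of_ne hs.2.2 hsx, lt_of_le_of_ne ht.2.1 hty,
    ht.2.2, Set.disjoint_left.2 fun z hz hz' ↦ ?_⟩
  rcases lt_or_ge z x with h | h
  · exact hz'.1.not_ge (le_csSup (bddAbove_Icc.mono inter_subset_right)
      ⟨hz, hs.2.1.trans hz'.1.le, h.le⟩)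
  rcases lt_or_ge y z with h' | h'
  · exact hz'.2.not_ge (csInf_le (bddBelow_Icc.mono inter_subset_right)
      ⟨hz, h'.le, hz'.2.le.trans ht.2.2⟩)
  · exact Set.disjoint_left.1 hd hz ⟨h, h'⟩

/-- `K` is a closed subset of `[0, 1]` containing both endpoints, such that `f` takes the same
value at the two ends of every complementary interval of `K`. -/
structure CollapsesGaps {X : Type*} (f : ℝ → X) (K : Set ℝ) : Prop where
  isClosed : IsClosed K
  subset : K ⊆ Icc 0 1
  zero_mem : 0 ∈ K
  one_mem : 1 ∈ K
  eq_of_gap : ∀ s ∈ K, ∀ t ∈ K, s < t → Disjoint K (Ioo s t) → f s = f t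

theorem exists_minimal_collapsesGaps {X : Type*} [MetricSpace X] {f : ℝ → X} (hf : Continuous f) :
    ∃ K, Minimal (CollapsesGaps f) K := by
  refine zorn_superset {K | CollapsesGaps f K} fun c hc hchain ↦ ?_
  rcases c.eq_empty_or_nonempty with rfl | hne
  · refine ⟨Icc 0 1, ⟨isClosed_Icc, subset_rfl, by simp, by simp, fun s hs t ht hst hd ↦ ?_⟩,
      by simp⟩
    obtain ⟨z, hz⟩ := exists_between hst
    exact absurd ⟨hs.1.trans hz.1.le, hz.2.le.trans ht.2⟩ fun h ↦ Set.disjoint_left.1 hd h hz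
  refine ⟨⋂₀ c, ⟨isClosed_sInter fun k hk ↦ (hc hk).isClosed, ?_, fun k hk ↦ (hc hk).zero_mem,
    fun k hk ↦ (hc hk).one_mem, fun s hs t ht hst hd ↦ ?_⟩, fun k hk ↦ sInter_subset_of_mem hk⟩
  · obtain ⟨k, hk⟩ := hne
    exact (sInter_subset_of_mem hk).trans (hc hk).subset
  by_contra hfst
  have hpos : 0 < dist (f s) (f t) / 2 := by have := dist_pos.2 hfst; linarith
  obtain ⟨δ, hδ, h1⟩ := Metric.continuousAt_iff.1 (hf.continuousAt (x := s)) _ hpos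
  obtain ⟨η, hη, h2⟩ := Metric.continuousAt_iff.1 (hf.continuousAt (x := t)) _ hpos
  obtain ⟨ε, hε0, hε⟩ : ∃ ε, 0 < ε ∧ ε < δ ∧ ε < η ∧ ε < (t - s) / 2 := by
    obtain ⟨ε, h, h'⟩ := exists_between
      (show 0 < min δ (min η ((t - s) / 2)) by simp [hδ, hη, hst])
    exact ⟨ε, h, by simpa using h'⟩
  have := hne.to_subtype
  obtain ⟨⟨k, hk⟩, hk'⟩ := (isCompact_Icc (a := s + ε) (b := t - ε)).elim_directed_family_closed
    (fun k : c ↦ (k : Set ℝ)) (fun k ↦ (hc k.2).isClosed) (by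
      rw [← sInter_eq_iInter, inter_comm, ← disjoint_iff_inter_eq_empty]
      exact hd.mono_right (Icc_subset_Ioo (by linarith) (by linarith)))
    (fun k l ↦ (hchain.total k.2 l.2).elim
      (fun h ↦ ⟨k, subset_rfl, h⟩) fun h ↦ ⟨l, h, subset_rfl⟩)
  obtain ⟨s', hs', t', ht', h3, h4, h5, h6, h7⟩ := exists_gap (hc hk).isClosed (hs k hk) (ht k hk)
    (x := s + ε) (y := t - ε) (by linarith) (by linarith) (by linarith)
    (by rwa [disjoint_iff_inter_eq_empty, inter_comm])
  have h8 := h1 (x := s') (by rw [Real.dist_eq, abs_of_nonneg] <;> linarith)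
  have h9 := h2 (x := t') (by rw [Real.dist_eq, abs_of_nonpos] <;> linarith)
  rw [(hc hk).eq_of_gap s' hs' t' ht' (by linarith) h7, dist_comm] at h8
  linarith [dist_triangle (f s) (f t') (f t)]

theorem disjoint_Ioo_of_minimal_collapsesGaps {X : Type*} {f : ℝ → X} {K : Set ℝ}
    (hK : Minimal (CollapsesGaps f) K) {s t : ℝ} (hs : s ∈ K) (ht : t ∈ K)
    (h : f s = f t) : Disjoint K (Ioo s t) := by
  obtain ⟨hc, hmin⟩ := hK
  refine (subset_sdiff.1 (hmin (y := K \ Ioo s t) ⟨hc.isClosed.sdiff isOpen_Ioo,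
    sdiff_subset.trans hc.subset, ⟨hc.zero_mem, fun h ↦ h.1.not_ge (hc.subset hs).1⟩,
    ⟨hc.one_mem, fun h ↦ h.2.not_ge (hc.subset ht).2⟩, fun u hu v hv huv hd ↦ ?_⟩
    sdiff_subset)).2
  by_cases hK : Disjoint K (Ioo u v)
  · exact hc.eq_of_gap u hu.1 v hv.1 huv hK
  obtain ⟨w, hw, hw'⟩ := Set.not_disjoint_iff.1 hK
  have hwst : w ∈ Ioo s t := by
    by_contra hn
    exact Set.disjoint_left.1 hd ⟨hw, hn⟩ hw'
  have hs1 : s ∉ Ioo u v := Set.disjoint_left.1 hd ⟨hs, by simp⟩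
  have ht1 : t ∉ Ioo u v := Set.disjoint_left.1 hd ⟨ht, by simp⟩
  have hu1 := hu.2
  have hv1 := hv.2
  simp only [mem_Ioo, not_and_or, not_lt] at *
  have : u = s := by grind
  have : v = t := by grind
  grind

/-- A path can be replaced by one with the same endpoints which is constant between any two
parameters at which it takes the same value. -/
theorem exists_monotone_path {X : Type*} [MetricSpace X] {f : ℝ → X} (hf : Continuous f) :
    ∃ g : ℝ → X, ContinuousOn g (Icc 0 1) ∧ g 0 = f 0 ∧ g 1 = f 1 ∧
      MapsTo g (Icc 0 1) (f '' Icc 0 1) ∧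
      ∀ x ∈ Icc (0 : ℝ) 1, ∀ y ∈ Icc (0 : ℝ) 1, x < y → g x = g y → ∀ z ∈ Icc x y, g z = g x := by
  obtain ⟨K, hK⟩ := exists_minimal_collapsesGaps hf
  have hc := hK.1
  have key : ∀ x ∈ Icc (0 : ℝ) 1, ∃ s ∈ K, ∃ t ∈ K, s ≤ x ∧ x ≤ t ∧ f s = f t ∧
      Disjoint K (Ioo s t) := by
    intro x hx
    by_cases hxK : x ∈ K
    · exact ⟨x, hxK, x, hxK, le_rfl, le_rfl, rfl, by simp⟩
    · obtain ⟨s, hs, t, ht, -, h1, h2, -, h3⟩ := exists_gap hc.isClosed hc.zero_mem hc.one_mem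
        hx.1 le_rfl hx.2 (by simpa using hxK)
      exact ⟨s, hs, t, ht, h1.le, h2.le, hc.eq_of_gap s hs t ht (h1.trans h2) h3, h3⟩
  choose! s hs t ht hsx hxt hst hd using key
  have hK_eq : ∀ x ∈ K, f (s x) = f x := by
    intro x hx
    have h0 := hc.subset hx
    have := Set.disjoint_left.1 (hd x h0) hx
    rcases (hsx x h0).eq_or_lt with h | h
    · rw [h]
    rcases (hxt x h0).eq_or_lt with h' | h'
    · rw [hst x h0, ← h']
    exact absurd ⟨h, h'⟩ this
  refine ⟨fun x ↦ f (s x), ?_, hK_eq 0 hc.zero_mem, hK_eq 1 hc.one_mem,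
    fun x hx ↦ mem_image_of_mem _ (hc.subset (hs x hx)), fun x hx y hy hxy hfxy z hz ↦ ?_⟩
  · intro x hx
    by_cases hxK : x ∈ K
    · rw [Metric.continuousWithinAt_iff]
      intro ε hε
      obtain ⟨δ, hδ, h1⟩ := Metric.continuousAt_iff.1 (hf.continuousAt (x := x)) ε hε
      refine ⟨δ, hδ, fun {y} hy hyx ↦ ?_⟩
      rw [hK_eq x hxK]
      have h2 := hsx y hy
      have h3 := hxt y hy
      have h4 := Set.disjoint_left.1 (hd y hy) hxK
      rw [Real.dist_eq, abs_lt] at hyx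
      rcases le_total x y with h | h
      · rcases h2.eq_or_lt with h5 | h5
        · refine h1 ?_
          rw [h5, Real.dist_eq, abs_lt]; exact hyx
        rcases le_or_gt x (s y) with h6 | h6
        · refine h1 ?_
          rw [Real.dist_eq, abs_lt]; constructor <;> linarith
        · rw [hst y hy]
          refine h1 ?_
          have h7 : t y ≤ x := by by_contra h8; exact h4 ⟨h6, not_le.1 h8⟩
          rw [Real.dist_eq, abs_lt]; constructor <;> linarith
      · rcases le_or_gt (t y) x with h6 | h6
        · rw [hst y hy]
          refine h1 ?_
          rw [Real.dist_eq, abs_lt]; constructor <;> linarith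
        · refine h1 ?_
          have h7 : x ≤ s y := by by_contra h8; exact h4 ⟨not_le.1 h8, h6⟩
          rw [Real.dist_eq, abs_lt]; constructor <;> linarith
    · have h1 : s x < x := lt_of_le_of_ne (hsx x hx) fun h ↦ hxK (h ▸ hs x hx)
      have h2 : x < t x := lt_of_le_of_ne (hxt x hx) fun h ↦ hxK (h ▸ ht x hx : x ∈ K)
      refine (continuousWithinAt_const (b := f (s x))).congr_of_eventuallyEq ?_ rfl
      filter_upwards [self_mem_nhdsWithin, mem_nhdsWithin_of_mem_nhds (Ioo_mem_nhds h1 h2)]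
        with y hy hy'
      have h3 := Set.disjoint_left.1 (hd x hx) (hs y hy)
      have h4 := Set.disjoint_left.1 (hd y hy) (hs x hx)
      have h5 := hsx y hy
      have h6 := hxt y hy
      simp only [mem_Ioo, not_and_or, not_lt] at *
      have : s y = s x := by grind
      rw [this]
  · have hz01 : z ∈ Icc (0 : ℝ) 1 := ⟨hx.1.trans hz.1, hz.2.trans hy.2⟩
    have h1 := hsx x hx
    have h2 := hxt y hy
    have h3 : f (s x) = f (t y) := by rw [← hst y hy]; exact hfxy
    have h4 := disjoint_Ioo_of_minimal_collapsesGaps hK (hs x hx) (ht y hy) h3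
    have h5 := Set.disjoint_left.1 h4 (hs z hz01)
    have h6 := Set.disjoint_left.1 (hd z hz01) (hs x hx)
    have h7 := hsx z hz01
    have h8 := hxt z hz01
    have h9 := hst z hz01
    obtain ⟨hz1, hz2⟩ := hz
    simp only [mem_Ioo, not_and_or, not_lt] at h5 h6
    rcases h5 with h5 | h5
    · rcases h5.eq_or_lt with h | h
      · change f (s z) = f (s x); rw [h]
      · have : t z = s x := by grind
        change f (s z) = f (s x); rw [h9, this]
    · have : s z = t y := by grind
      change f (s z) = f (s x); rw [this, h3]

/-- A continuous monotone real function which increases exactly where the set of values taken so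
far by the path `g` grows. -/
theorem exists_monotone_size {X : Type*} [MetricSpace X] [TopologicalSpace.SeparableSpace X]
    {g : ℝ → X} (hg : Continuous g) :
    ∃ φ : ℝ → ℝ, Continuous φ ∧
      (∀ s ∈ Icc (0 : ℝ) 1, ∀ t ∈ Icc (0 : ℝ) 1, g '' Icc 0 s = g '' Icc 0 t → φ s = φ t) ∧
      ∀ s ∈ Icc (0 : ℝ) 1, ∀ t ∈ Icc (0 : ℝ) 1, s < t → g t ∉ g '' Icc 0 s → φ s < φ t := by
  have : Nonempty X := ⟨g 0⟩
  let q := TopologicalSpace.denseSeq X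
  let m : ℕ → ℝ → ℝ := fun n t ↦ sInf ((fun s ↦ min 1 (dist (q n) (g (t * s)))) '' Icc 0 1)
  have hm : ∀ n, Continuous (m n) := fun n ↦
    isCompact_Icc.continuous_sInf (f := fun t s : ℝ ↦ min 1 (dist (q n) (g (t * s)))) (by fun_prop)
  have himage : ∀ n, ∀ t ∈ Icc (0 : ℝ) 1,
      m n t = sInf ((fun x ↦ min 1 (dist (q n) x)) '' (g '' Icc 0 t)) := by
    intro n t ht
    have : Icc 0 t = (fun s ↦ t * s) '' Icc 0 1 := by
      rw [image_mul_left_Icc ht.1 zero_le_one]; simp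
    rw [this, image_image, image_image]
  have hbdd : ∀ n (S : Set X), BddBelow ((fun x ↦ min 1 (dist (q n) x)) '' S) := fun n S ↦
    ⟨0, by rintro _ ⟨x, -, rfl⟩; positivity⟩
  have hm0 : ∀ n, ∀ t, 0 ≤ m n t := fun n t ↦
    Real.sInf_nonneg (by rintro _ ⟨x, -, rfl⟩; positivity)
  have hm1 : ∀ n, ∀ t, m n t ≤ 1 := fun n t ↦
    (csInf_le ⟨0, by rintro _ ⟨x, -, rfl⟩; positivity⟩
      (mem_image_of_mem _ (left_mem_Icc.2 zero_le_one))).trans (min_le_left _ _)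
  have hbound : ∀ n t, ‖(1 / 2 : ℝ) ^ n * (1 - m n t)‖ ≤ (1 / 2 : ℝ) ^ n := by
    intro n t
    rw [Real.norm_of_nonneg (mul_nonneg (by positivity) (by linarith [hm1 n t]))]
    exact mul_le_of_le_one_right (by positivity) (by linarith [hm0 n t])
  have hsum : ∀ t, Summable fun n ↦ (1 / 2 : ℝ) ^ n * (1 - m n t) := fun t ↦
    Summable.of_norm_bounded summable_geometric_two fun n ↦ hbound n t
  refine ⟨fun t ↦ ∑' n, (1 / 2 : ℝ) ^ n * (1 - m n t),
    continuous_tsum (fun n ↦ continuous_const.mul (continuous_const.sub (hm n)))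
      summable_geometric_two hbound, fun s hs t ht hst ↦ ?_, fun s hs t ht hst hgt ↦ ?_⟩
  · simp only [himage _ s hs, himage _ t ht, hst]
  · have hmono : ∀ n, m n t ≤ m n s := by
      intro n
      rw [himage n s hs, himage n t ht]
      refine csInf_le_csInf (hbdd n _) ?_
        (image_mono (image_mono (Icc_subset_Icc_right hst.le)))
      exact ((nonempty_Icc.2 hs.1).image _).image _
    have hclosed : IsClosed (g '' Icc 0 s) := (isCompact_Icc.image hg).isClosed
    obtain ⟨r, hr, hrd⟩ := Metric.isOpen_iff.1 hclosed.isOpen_compl _ hgt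
    obtain ⟨n, hn⟩ := (TopologicalSpace.denseRange_denseSeq X).exists_dist_lt (g t)
      (show 0 < min r 1 / 2 by positivity)
    rw [dist_comm] at hn
    change dist (q n) (g t) < _ at hn
    have hlt : m n t < m n s := by
      have h1 : m n t ≤ dist (q n) (g t) := by
        rw [himage n t ht]
        exact (csInf_le (hbdd n _) (mem_image_of_mem _
          (mem_image_of_mem g (right_mem_Icc.2 ht.1)))).trans (min_le_right _ _)
      have h2 : min r 1 / 2 ≤ m n s := by
        rw [himage n s hs]
        refine le_csInf (((nonempty_Icc.2 hs.1).image _).image _) ?_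
        rintro _ ⟨x, hx, rfl⟩
        refine le_min (by linarith [min_le_right r 1]) ?_
        have h3 : r ≤ dist x (g t) := by
          by_contra h
          exact hrd (Metric.mem_ball.2 (not_le.1 h)) hx
        have h4 := dist_triangle_left x (g t) (q n)
        linarith [min_le_left r 1]
      exact h1.trans_lt (hn.trans_le h2)
    refine Summable.tsum_lt_tsum (i := n) (fun k ↦ ?_) ?_ (hsum s) (hsum t)
    · exact mul_le_mul_of_nonneg_left (by linarith [hmono k]) (by positivity)
    · exact mul_lt_mul_of_pos_left (by linarith) (by positivity)

/-- Two distinct points joined by a path in a separable metric space are joined by an arc inside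
the image of that path. -/
theorem exists_arc_of_path {X : Type*} [MetricSpace X] [TopologicalSpace.SeparableSpace X]
    {f : ℝ → X} (hf : ContinuousOn f (Icc 0 1)) (hne : f 0 ≠ f 1) :
    ∃ γ : ℝ → X, ContinuousOn γ (Icc 0 1) ∧ InjOn γ (Icc 0 1) ∧ γ 0 = f 0 ∧ γ 1 = f 1 ∧
      MapsTo γ (Icc 0 1) (f '' Icc 0 1) := by
  have hext : ∀ h : ℝ → X, ∀ t ∈ Icc (0 : ℝ) 1,
      IccExtend (zero_le_one' ℝ) ((Icc 0 1).domRestrict h) t = h t := fun h t ht ↦ by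
    rw [IccExtend_of_mem _ _ ht, domRestrict_apply]
  obtain ⟨g₀, hg₀, h0, h1, hgf, hconst⟩ := exists_monotone_path
    (f := IccExtend (zero_le_one' ℝ) ((Icc 0 1).domRestrict f)) hf.domRestrict.Icc_extend'
  rw [hext f 0 (by simp)] at h0
  rw [hext f 1 (by simp)] at h1
  rw [image_congr (hext f)] at hgf
  obtain ⟨g, hg, hgg⟩ : ∃ g : ℝ → X, Continuous g ∧ ∀ t ∈ Icc (0 : ℝ) 1, g t = g₀ t :=
    ⟨_, hg₀.domRestrict.Icc_extend', hext g₀⟩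
  rw [← hgg 0 (by simp)] at h0
  rw [← hgg 1 (by simp)] at h1
  replace hgf : MapsTo g (Icc 0 1) (f '' Icc 0 1) := fun t ht ↦ hgg t ht ▸ hgf ht
  replace hconst : ∀ x ∈ Icc (0 : ℝ) 1, ∀ y ∈ Icc (0 : ℝ) 1, x < y → g x = g y →
      ∀ z ∈ Icc x y, g z = g x := by
    intro x hx y hy hxy h z hz
    rw [hgg z ⟨hx.1.trans hz.1, hz.2.trans hy.2⟩]
    rw [hgg x hx, hgg y hy] at h
    rw [hgg x hx]
    exact hconst x hx y hy hxy h z hz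
  obtain ⟨φ, hφ, hφeq, hφlt⟩ := exists_monotone_size hg
  have heq_lt : ∀ s ∈ Icc (0 : ℝ) 1, ∀ t ∈ Icc (0 : ℝ) 1, s < t → g s = g t → φ s = φ t := by
    intro s hs t ht hst h
    refine hφeq s hs t ht (Subset.antisymm (image_mono (Icc_subset_Icc_right hst.le)) ?_)
    rintro _ ⟨z, hz, rfl⟩
    rcases le_total z s with h' | h'
    · exact mem_image_of_mem _ ⟨hz.1, h'⟩
    · rw [hconst s hs t ht hst h z ⟨h', hz.2⟩]
      exact mem_image_of_mem _ (right_mem_Icc.2 hs.1)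
  have hlt_of_ne : ∀ s ∈ Icc (0 : ℝ) 1, ∀ t ∈ Icc (0 : ℝ) 1, s < t → g s ≠ g t → φ s < φ t := by
    rintro s hs t ht hst h
    refine hφlt s hs t ht hst ?_
    rintro ⟨z, hz, hzt⟩
    have hz1 : z ∈ Icc (0 : ℝ) 1 := ⟨hz.1, hz.2.trans hs.2⟩
    exact h ((hconst z hz1 t ht (hz.2.trans_lt hst) hzt s ⟨hz.2, hst.le⟩).trans hzt)
  have hiff : ∀ s ∈ Icc (0 : ℝ) 1, ∀ t ∈ Icc (0 : ℝ) 1, φ s = φ t ↔ g s = g t := by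
    intro s hs t ht
    rcases lt_trichotomy s t with h | rfl | h
    · exact ⟨fun h' ↦ by_contra fun h'' ↦ (hlt_of_ne s hs t ht h h'').ne h',
        heq_lt s hs t ht h⟩
    · simp
    · exact ⟨fun h' ↦ by_contra fun h'' ↦ (hlt_of_ne t ht s hs h (Ne.symm h'')).ne' h',
        fun h' ↦ (heq_lt t ht s hs h h'.symm).symm⟩
  have hmono : ∀ s ∈ Icc (0 : ℝ) 1, ∀ t ∈ Icc (0 : ℝ) 1, s ≤ t → φ s ≤ φ t := by
    intro s hs t ht hst
    rcases hst.eq_or_lt with rfl | h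
    · rfl
    by_cases h' : g s = g t
    · exact (heq_lt s hs t ht h h').le
    · exact (hlt_of_ne s hs t ht h h').le
  have h01 : φ 0 < φ 1 :=
    hlt_of_ne 0 (by simp) 1 (by simp) one_pos (by rwa [h0, h1])
  let Φ : ℝ → ℝ := fun t ↦ (φ t - φ 0) / (φ 1 - φ 0)
  have hΦ : Continuous Φ := by fun_prop
  have hpos : 0 < φ 1 - φ 0 := sub_pos.2 h01
  have hΦ0 : Φ 0 = 0 := by simp [Φ]
  have hΦ1 : Φ 1 = 1 := div_self hpos.ne'
  have hΦiff : ∀ s ∈ Icc (0 : ℝ) 1, ∀ t ∈ Icc (0 : ℝ) 1, Φ s = Φ t ↔ g s = g t := by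
    intro s hs t ht
    rw [← hiff s hs t ht, div_left_inj' hpos.ne', sub_left_inj]
  have hmaps : MapsTo Φ (Icc 0 1) (Icc 0 1) := fun t ht ↦
    ⟨div_nonneg (sub_nonneg.2 (hmono 0 (by simp) t ht ht.1)) hpos.le,
      (div_le_one hpos).2 (sub_le_sub_right (hmono t ht 1 (by simp) ht.2) _)⟩
  have hsurj : ∀ u ∈ Icc (0 : ℝ) 1, ∃ t ∈ Icc (0 : ℝ) 1, Φ t = u := fun u hu ↦ by
    have := intermediate_value_Icc (zero_le_one' ℝ) hΦ.continuousOn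
    rw [hΦ0, hΦ1] at this
    exact this hu
  choose! ψ hψ hΦψ using hsurj
  have hψΦ : ∀ t ∈ Icc (0 : ℝ) 1, g (ψ (Φ t)) = g t := fun t ht ↦
    (hΦiff _ (hψ _ (hmaps ht)) t ht).1 (hΦψ _ (hmaps ht))
  refine ⟨g ∘ ψ, continuousOn_iff_isClosed.2 fun C hC ↦ ⟨Φ '' (g ⁻¹' C ∩ Icc 0 1), ?_, ?_⟩,
    fun u hu v hv huv ↦ ?_, ?_, ?_, fun u hu ↦ hgf (hψ u hu)⟩
  · exact ((isCompact_Icc.inter_left (hC.preimage hg)).image hΦ).isClosed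
  · ext u
    constructor
    · rintro ⟨hu, hu'⟩
      exact ⟨⟨ψ u, ⟨hu, hψ u hu'⟩, hΦψ u hu'⟩, hu'⟩
    · rintro ⟨⟨t, ⟨ht, ht'⟩, rfl⟩, hu'⟩
      exact ⟨by simpa [hψΦ t ht'] using ht, hu'⟩
  · rw [← hΦψ u hu, ← hΦψ v hv]
    exact (hΦiff _ (hψ u hu) _ (hψ v hv)).2 huv
  · rw [← h0, ← hψΦ 0 (by simp), hΦ0]; rfl
  · rw [← h1, ← hψΦ 1 (by simp), hΦ1]; rfl

open Filter Topology

/-- Countably many paths, the `n`-th one inside `U ∩ ball a (ε n)` with `ε n → 0`, concatenate to a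
path which ends at `a` and stays in `U` before. -/
theorem exists_path_of_joinedIn {E : Type*} [NormedAddCommGroup E] {U : Set E} {a : E}
    {x : ℕ → E} {ε : ℕ → ℝ} (hε : Tendsto ε atTop (𝓝 0))
    (hx : ∀ n, JoinedIn (U ∩ Metric.ball a (ε n)) (x n) (x (n + 1))) :
    ∃ f : ℝ → E, ContinuousOn f (Icc 0 1) ∧ f 0 = x 0 ∧ f 1 = a ∧ ∀ t ∈ Ico (0 : ℝ) 1, f t ∈ U := by
  choose γ hγ using hx
  let S : ℕ → ℝ → E := fun N t ↦ x 0 + ∑ k ∈ Finset.range N, ((γ k).extend (t - k) - x k)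
  have hS : ∀ N, Continuous (S N) := fun N ↦ by
    refine continuous_const.add (continuous_finsetSum _ fun k _ ↦ ?_)
    exact ((γ k).continuous_extend.comp (by fun_prop)).sub continuous_const
  have hS_succ : ∀ N t, S (N + 1) t = S N t + ((γ N).extend (t - N) - x N) := fun N t ↦ by
    simp only [S, Finset.sum_range_succ, add_assoc]
  have hS_eq : ∀ N M : ℕ, ∀ t : ℝ, t ≤ N → N ≤ M → S M t = S N t := by
    intro N M t ht hNM
    induction M, hNM using Nat.le_induction with
    | base => rfl
    | succ M hM ih =>
      rw [← ih]
      have : t - M ≤ 0 := by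
        have : (N : ℝ) ≤ M := by exact_mod_cast hM
        linarith
      rw [hS_succ, (γ M).extend_of_le_zero this, sub_self, add_zero]
  have hS_nat : ∀ N : ℕ, ∀ t : ℝ, N ≤ t → S N t = x N := by
    intro N t ht
    induction N with
    | zero => simp [S]
    | succ N ih =>
      push_cast at ht
      rw [hS_succ, ih (by linarith), (γ N).extend_of_one_le (by linarith)]
      abel
  let h : ℝ → E := fun t ↦ S ⌈t⌉₊ t
  have hh : ∀ N : ℕ, ∀ t : ℝ, t ≤ N → h t = S N t := fun N t ht ↦
    (hS_eq _ N t (Nat.le_ceil t) (Nat.ceil_le.2 ht)).symm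
  have hcont : Continuous h := by
    rw [continuous_iff_continuousAt]
    intro t
    obtain ⟨N, hN⟩ := exists_nat_gt t
    refine (hS N).continuousAt.congr ?_
    filter_upwards [Iio_mem_nhds hN] with s hs
    exact (hh N s (le_of_lt hs)).symm
  have hmem : ∀ t, 0 ≤ t → h t ∈ U ∩ Metric.ball a (ε ⌊t⌋₊) := by
    intro t ht
    rw [hh (⌊t⌋₊ + 1) t (by push_cast; exact (Nat.lt_floor_add_one t).le), hS_succ,
      hS_nat _ _ (Nat.floor_le ht), add_sub_cancel]
    exact hγ _ _
  refine ⟨fun t ↦ if t < 1 then h (t / (1 - t)) else a, ?_, ?_, by simp, ?_⟩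
  · intro t ht
    rcases ht.2.lt_or_eq with h1 | rfl
    · have : ContinuousAt (fun t ↦ h (t / (1 - t))) t :=
        hcont.continuousAt.comp (f := fun t ↦ t / (1 - t))
          (continuousAt_id.div (by fun_prop) (by linarith))
      refine (this.congr ?_).continuousWithinAt
      filter_upwards [Iio_mem_nhds h1] with s hs
      exact (if_pos hs).symm
    · rw [Metric.continuousWithinAt_iff]
      intro e he
      obtain ⟨N, hN⟩ := eventually_atTop.1 (hε.eventually_lt_const he)
      refine ⟨1 / (N + 1), by positivity, fun {s} hs hs1 ↦ ?_⟩
      simp only [lt_self_iff_false, if_false]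
      split_ifs with h1
      · have h2 : 0 < 1 - s := sub_pos.2 h1
        have h3 : (N : ℝ) ≤ s / (1 - s) := by
          rw [Real.dist_eq, abs_sub_comm, abs_of_pos h2, lt_div_iff₀ (by positivity)] at hs1
          rw [le_div_iff₀ h2]
          linarith
        have h4 := (hmem (s / (1 - s)) (div_nonneg hs.1 h2.le)).2
        exact (Metric.mem_ball.1 h4).trans (hN _ (Nat.le_floor h3))
      · simpa using he
  · have := hh 0 0 (by simp)
    simp [this, S]
  · intro t ht
    simp only [ht.2, if_true]
    exact (hmem _ (div_nonneg ht.1 (sub_nonneg.2 ht.2.le))).1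

theorem IsPreconnected.subset_ball_of_disjoint_sphere {C : Set ℂ} (hC : IsPreconnected C) {a x : ℂ}
    {ε : ℝ} (hd : Disjoint C (Metric.sphere a ε)) (hx : x ∈ C) (hxa : x ∈ Metric.ball a ε) :
    C ⊆ Metric.ball a ε := by
  refine hC.subset_left_of_subset_union Metric.isOpen_ball
    (Metric.isClosed_closedBall (x := a) (ε := ε)).isOpen_compl ?_ ?_ ⟨x, hx, hxa⟩
  · exact Set.disjoint_left.2 fun z hz hz' ↦ hz' (Metric.ball_subset_closedBall hz)
  · intro z hz
    rcases lt_trichotomy (dist z a) ε with h | h | h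
    · exact Or.inl h
    · exact absurd h (Set.disjoint_left.1 hd hz)
    · exact Or.inr (by simpa using h)

/-- Let `U` be a complementary domain of `K`. If removing from `K` a small piece around `a` leaves
a connected set `T`, then points of `U` near `a` can be joined in `U` near `a`. -/
theorem exists_forall_joinedIn_inter_ball {K T U : Set ℂ} {a : ℂ} {ε : ℝ} (hε : 0 < ε)
    (hK : IsClosed K) (hT : IsClosed T) (hTK : T ⊆ K) (hTc : IsPreconnected T) (haT : a ∉ T)
    (hKT : K \ T ⊆ Metric.ball a ε) (hU : IsPreconnected U) (hUK : Disjoint U K)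
    (hmax : ∀ C, IsPreconnected C → Disjoint C K → (C ∩ U).Nonempty → C ⊆ U) :
    ∃ δ > 0, ∀ x ∈ U ∩ Metric.ball a δ, ∀ y ∈ U ∩ Metric.ball a δ,
      JoinedIn (U ∩ Metric.ball a ε) x y := by
  obtain ⟨r, hr, hrT⟩ := Metric.isOpen_iff.1 hT.isOpen_compl a haT
  refine ⟨min r ε, lt_min hr hε, fun x hx y hy ↦ ?_⟩
  have hB : IsClosed (T ∪ Metric.sphere a ε) := hT.union Metric.isClosed_sphere
  have hinter : K ∩ (T ∪ Metric.sphere a ε) = T := by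
    refine Subset.antisymm ?_ fun z hz ↦ ⟨hTK hz, Or.inl hz⟩
    rintro z ⟨hz, hz' | hz'⟩
    · exact hz'
    · by_contra hzT
      exact (Metric.mem_ball.1 (hKT ⟨hz, hzT⟩)).ne hz'
  have hdisj : Disjoint (Metric.ball a (min r ε)) (T ∪ Metric.sphere a ε) := by
    refine Set.disjoint_left.2 fun z hz ↦ ?_
    rintro (hz' | hz')
    · exact hrT (Metric.ball_subset_ball (min_le_left _ _) hz) hz'
    · exact (Metric.mem_ball.1 (Metric.ball_subset_ball (min_le_right _ _) hz)).ne hz'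
  set W := connectedComponentIn (K ∪ (T ∪ Metric.sphere a ε))ᶜ x with hW
  have hxW : x ∈ W := mem_connectedComponentIn (by
    rintro (h | h)
    · exact Set.disjoint_left.1 hUK hx.1 h
    · exact Set.disjoint_left.1 hdisj hx.2 h)
  have hWs : Disjoint W (K ∪ (T ∪ Metric.sphere a ε)) :=
    Set.disjoint_left.2 fun z hz ↦ connectedComponentIn_subset _ _ hz
  have hWc : IsPreconnected W := isPreconnected_connectedComponentIn
  have hWball : W ⊆ Metric.ball a ε := hWc.subset_ball_of_disjoint_sphere
    (hWs.mono_right (subset_union_right.trans subset_union_right)) hxW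
    (Metric.ball_subset_ball (min_le_right _ _) hx.2)
  have hyW : y ∈ W := mem_connectedComponentIn_compl_union hK hB (by rwa [hinter]) hU hUK
    (convex_ball a _).isPreconnected hdisj hx.1 hy.1 hx.2 hy.2 (Metric.isBounded_ball.subset hWball)
  have hWpath : IsPathConnected W := ((hK.union hB).isOpen_compl.connectedComponentIn
    |>.isConnected_iff_isPathConnected).1 ⟨⟨x, hxW⟩, hWc⟩
  exact (hWpath.joinedIn x hxW y hyW).mono (subset_inter
    (hmax W hWc (hWs.mono_right subset_union_left) ⟨x, hxW, hx.1⟩) hWball)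

theorem mem_accessiblePts_of_forall_exists {K U : Set ℂ} {a : ℂ} (hK : IsClosed K)
    (hUo : IsOpen U) (hU : IsPreconnected U) (hUK : Disjoint U K)
    (hmax : ∀ C, IsPreconnected C → Disjoint C K → (C ∩ U).Nonempty → C ⊆ U)
    (haU : a ∈ frontier U)
    (hT : ∀ ε > 0, ∃ T, IsClosed T ∧ IsPreconnected T ∧ T ⊆ K ∧ a ∉ T ∧ K \ T ⊆ Metric.ball a ε) :
    a ∈ accessiblePts U := by
  have hloc : ∀ n : ℕ, ∃ δ > 0, ∀ x ∈ U ∩ Metric.ball a δ, ∀ y ∈ U ∩ Metric.ball a δ,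
      JoinedIn (U ∩ Metric.ball a (1 / ((n : ℝ) + 1))) x y := by
    intro n
    obtain ⟨T, h1, h2, h3, h4, h5⟩ := hT (1 / ((n : ℝ) + 1)) (by positivity)
    exact exists_forall_joinedIn_inter_ball (by positivity) hK h1 h3 h2 h4 h5 hU hUK hmax
  choose δ hδ hjoin using hloc
  have hx : ∀ n, ∃ x ∈ U, dist a x < min (δ n) (δ (n - 1)) := fun n ↦
    Metric.mem_closure_iff.1 haU.1 _ (lt_min (hδ _) (hδ _))
  choose x hxU hxa using hx
  obtain ⟨f, hf, hf0, hf1, hfU⟩ := exists_path_of_joinedIn (U := U) (a := a) (x := x)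
    tendsto_one_div_add_atTop_nhds_zero_nat fun n ↦ by
      refine hjoin n _ ⟨hxU n, ?_⟩ _ ⟨hxU _, ?_⟩
      · rw [Metric.mem_ball']; exact (hxa n).trans_le (min_le_left _ _)
      · rw [Metric.mem_ball']; exact (hxa (n + 1)).trans_le (min_le_right _ _)
  have ha : a ∉ U := fun h ↦
    Set.disjoint_left.1 (Set.disjoint_iff_inter_eq_empty.2 hUo.inter_frontier_eq) h haU
  obtain ⟨γ, hγ, hinj, -, hγ1, hmaps⟩ := exists_arc_of_path hf (by
    rw [hf0, hf1]; exact ne_of_mem_of_not_mem (hxU 0) ha)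
  refine ⟨haU, γ, hγ, hinj, ?_, hγ1.trans hf1⟩
  rintro _ ⟨t, ht, rfl⟩
  obtain ⟨s, hs, hst⟩ := hmaps ⟨ht.1, ht.2.le⟩
  rcases hs.2.lt_or_eq with h | rfl
  · exact hst ▸ hfU s ⟨hs.1, h⟩
  · exact absurd (hinj ⟨ht.1, ht.2.le⟩ (by simp) (hst.symm.trans hγ1.symm)) ht.2.ne

/-- A closed curve `g` based at `a`, together with a cross arc `γ` ending on it away from `a`,
stays connected after removing a suitable small piece around `a`. -/
theorem exists_isPreconnected_sdiff_subset_ball {g γ : ℝ → ℂ} {a : ℂ} (hg : Continuous g)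
    (hγ : ContinuousOn γ (Icc 0 1)) (hg0 : g 0 = a) (hg1 : g 1 = a)
    (hga : ∀ t ∈ Ioo (0 : ℝ) 1, g t ≠ a) (hγ1 : γ 1 ∈ g '' Ioo 0 1)
    (hγa : ∀ t ∈ Ioc (0 : ℝ) 1, γ t ≠ a) {ε : ℝ} (hε : 0 < ε) :
    ∃ T, IsClosed T ∧ IsPreconnected T ∧ T ⊆ g '' Icc 0 1 ∪ γ '' Icc 0 1 ∧ a ∉ T ∧
      (g '' Icc 0 1 ∪ γ '' Icc 0 1) \ T ⊆ Metric.ball a ε := by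
  obtain ⟨τ, hτ, hτγ⟩ := hγ1
  obtain ⟨δ, hδ, h1⟩ := Metric.continuousAt_iff.1 (hg.continuousAt (x := 0)) ε hε
  obtain ⟨η, hη, h2⟩ := Metric.continuousAt_iff.1 (hg.continuousAt (x := 1)) ε hε
  rw [hg0] at h1
  rw [hg1] at h2
  obtain ⟨t, ht0, ht⟩ : ∃ t, 0 < t ∧ t < δ ∧ t < η ∧ t < τ ∧ t < 1 - τ := by
    obtain ⟨t, h, h'⟩ := exists_between
      (show 0 < min δ (min η (min τ (1 - τ))) by simp [hδ, hη, hτ.1, hτ.2])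
    exact ⟨t, h, by simpa using h'⟩
  obtain ⟨htδ, htη, htτ, htτ'⟩ := ht
  obtain ⟨s, hs, has, hsb⟩ : ∃ s ∈ Icc (0 : ℝ) 1, a ∉ γ '' Icc s 1 ∧
      ∀ r ∈ Ico 0 s, γ r ∈ Metric.ball a ε := by
    by_cases h0 : γ 0 = a
    · obtain ⟨ρ, hρ, h3⟩ := Metric.continuousWithinAt_iff.1 (hγ 0 (by simp)) ε hε
      rw [h0] at h3
      refine ⟨min ρ 1, ⟨by positivity, min_le_right _ _⟩, ?_, fun r hr ↦ ?_⟩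
      · rintro ⟨r, hr, hra⟩
        exact hγa r ⟨lt_of_lt_of_le (by positivity) hr.1, hr.2⟩ hra
      · refine h3 ⟨hr.1, hr.2.le.trans (min_le_right _ _)⟩ ?_
        rw [Real.dist_eq, sub_zero, abs_of_nonneg hr.1]
        exact hr.2.trans_le (min_le_left _ _)
    · refine ⟨0, by simp, ?_, by simp⟩
      rintro ⟨r, hr, hra⟩
      rcases hr.1.eq_or_lt with rfl | h
      · exact h0 hra
      · exact hγa r ⟨h, hr.2⟩ hra
  have hγs : ContinuousOn γ (Icc s 1) := hγ.mono (Icc_subset_Icc_left hs.1)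
  refine ⟨g '' Icc t (1 - t) ∪ γ '' Icc s 1, ?_, ?_, ?_, ?_, ?_⟩
  · exact ((isCompact_Icc.image hg).union (isCompact_Icc.image_of_continuousOn hγs)).isClosed
  · exact IsPreconnected.union (γ 1) ⟨τ, ⟨htτ.le, by linarith⟩, hτγ⟩ ⟨1, ⟨hs.2, le_rfl⟩, rfl⟩
      (isPreconnected_Icc.image _ hg.continuousOn) (isPreconnected_Icc.image _ hγs)
  · exact union_subset_union (image_mono (Icc_subset_Icc ht0.le (by linarith)))
      (image_mono (Icc_subset_Icc_left hs.1))
  · rintro (⟨r, hr, hra⟩ | h)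
    · exact hga r ⟨by linarith [hr.1], by linarith [hr.2]⟩ hra
    · exact has h
  · rintro _ ⟨⟨r, hr, rfl⟩ | ⟨r, hr, rfl⟩, hn⟩
    · rcases lt_or_ge r t with h | h
      · refine h1 ?_
        rw [Real.dist_eq, abs_lt]; constructor <;> linarith [hr.1]
      rcases lt_or_ge (1 - t) r with h' | h'
      · refine h2 ?_
        rw [Real.dist_eq, abs_lt]; constructor <;> linarith [hr.2]
      · exact absurd (Or.inl ⟨r, ⟨h, h'⟩, rfl⟩) hn
    · rcases lt_or_ge r s with h | h
      · exact hsb r ⟨hr.1, h⟩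
      · exact absurd (Or.inr ⟨r, ⟨h, hr.2⟩, rfl⟩) hn

/-- A Jordan curve can be traversed as a loop which visits its base point only at the ends. -/
theorem IsJordanCurve.exists_loop {Γ : Set ℂ} (hΓ : IsJordanCurve Γ) {a : ℂ} (ha : a ∈ Γ) :
    ∃ g : ℝ → ℂ, Continuous g ∧ g 0 = a ∧ g 1 = a ∧ (∀ t ∈ Ioo (0 : ℝ) 1, g t ≠ a) ∧
      g '' Icc 0 1 = Γ := by
  obtain ⟨f, hf, hinj, rfl⟩ := hΓ
  obtain ⟨u, hu, rfl⟩ := ha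
  have hu0 : u ≠ 0 := by rintro rfl; simp at hu
  have hmem : ∀ t : ℝ, u * Complex.exp ((2 * Real.pi * t : ℝ) * Complex.I) ∈
      Metric.sphere (0 : ℂ) 1 := by
    intro t
    rw [mem_sphere_zero_iff_norm] at hu ⊢
    rw [norm_mul, hu, Complex.norm_exp_ofReal_mul_I, one_mul]
  refine ⟨fun t ↦ f (u * Complex.exp ((2 * Real.pi * t : ℝ) * Complex.I)),
    hf.comp_continuous (by fun_prop) hmem, by simp, by simp [Complex.exp_two_pi_mul_I],
    fun t ht h ↦ ?_, Subset.antisymm ?_ ?_⟩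
  · have h1 := hinj (hmem t) hu h
    rw [mul_eq_left₀ hu0, Complex.exp_eq_one_iff] at h1
    obtain ⟨n, hn⟩ := h1
    have h2 : (t : ℂ) = n := by
      have := Complex.two_pi_I_ne_zero
      apply mul_left_cancel₀ this
      push_cast at hn
      linear_combination hn
    have h3 : t = n := by exact_mod_cast h2
    rw [h3] at ht
    have h4 : (0 : ℤ) < n := by exact_mod_cast ht.1
    have h5 : n < (1 : ℤ) := by exact_mod_cast ht.2
    omega
  · rintro _ ⟨t, -, rfl⟩
    exact mem_image_of_mem f (hmem t)
  · rintro _ ⟨w, hw, rfl⟩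
    rw [mem_sphere_zero_iff_norm] at hu hw
    have h1 : Complex.exp ((w / u).arg * Complex.I) = w / u := by
      have := Complex.norm_mul_exp_arg_mul_I (w / u)
      rwa [norm_div, hu, hw, div_one, Complex.ofReal_one, one_mul] at this
    refine ⟨Int.fract ((w / u).arg / (2 * Real.pi)), ⟨Int.fract_nonneg _, (Int.fract_lt_one _).le⟩,
      congrArg f ?_⟩
    have h2 : (2 * Real.pi * Int.fract ((w / u).arg / (2 * Real.pi)) : ℝ) * Complex.I =
        (w / u).arg * Complex.I - ⌊(w / u).arg / (2 * Real.pi)⌋ * (2 * Real.pi * Complex.I) := by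
      rw [Int.fract]
      push_cast
      have := Complex.ofReal_ne_zero.2 Real.pi_ne_zero
      field_simp
    rw [h2, Complex.exp_periodic.sub_int_mul_eq, h1, mul_div_cancel₀ _ hu0]

theorem mem_accessiblePts_of_crosscut {G J U V : Set ℂ} (hG : IsOpen G)
    (hΓ : IsJordanCurve (frontier G)) (hJ : IsCrosscut G J) (hU : IsOpen U) (hV : IsOpen V)
    (hUc : IsPreconnected U) (hUV : Disjoint U V) (hGJ : G \ J = U ∪ V) {a : ℂ}
    (ha : a ∈ frontier G) (haU : a ∈ frontier U) : a ∈ accessiblePts U := by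
  obtain ⟨γ, hγ, hinj, rfl, hJG, hγ0, hγ1⟩ := hJ
  obtain ⟨g, hg, hg0, hg1, hga, hgΓ⟩ := hΓ.exists_loop ha
  have hGf : Disjoint G (frontier G) :=
    Set.disjoint_iff_inter_eq_empty.2 hG.inter_frontier_eq
  have hγIcc : γ '' Icc 0 1 ⊆ γ '' Ioo 0 1 ∪ frontier G := by
    rintro _ ⟨t, ht, rfl⟩
    rcases ht.1.eq_or_lt with rfl | h
    · exact Or.inr hγ0
    rcases ht.2.eq_or_lt with rfl | h'
    · exact Or.inr hγ1
    · exact Or.inl ⟨t, ⟨h, h'⟩, rfl⟩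
  set K := g '' Icc 0 1 ∪ γ '' Icc 0 1 with hKdef
  have hK : IsClosed K :=
    ((isCompact_Icc.image hg).union (isCompact_Icc.image_of_continuousOn hγ)).isClosed
  have hUG : U ⊆ G \ γ '' Ioo 0 1 := hGJ ▸ subset_union_left
  have hUK : Disjoint U K := by
    refine Set.disjoint_left.2 fun z hz hzK ↦ ?_
    have h1 : z ∈ γ '' Ioo 0 1 ∪ frontier G := by
      rcases hzK with h | h
      · exact Or.inr (hgΓ ▸ h)
      · exact hγIcc h
    exact h1.elim (hUG hz).2 (Set.disjoint_left.1 hGf (hUG hz).1)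
  have hfr : frontier U ⊆ K := by
    intro z hz
    by_cases hzG : z ∈ G
    · by_cases hzJ : z ∈ γ '' Ioo 0 1
      · exact Or.inr (image_mono Ioo_subset_Icc_self hzJ)
      · rcases (hGJ ▸ ⟨hzG, hzJ⟩ : z ∈ U ∪ V) with h | h
        · exact absurd (hU.inter_frontier_eq.subset ⟨h, hz⟩) (Set.notMem_empty z)
        · exact absurd h (Set.disjoint_left.1 (hUV.closure_left hV) hz.1)
    · refine Or.inl (hgΓ ▸ ?_)
      rw [hG.frontier_eq]
      exact ⟨closure_mono (hUG.trans sdiff_subset) hz.1, hzG⟩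
  have hmax : ∀ C, IsPreconnected C → Disjoint C K → (C ∩ U).Nonempty → C ⊆ U := by
    intro C hC hCK hne
    refine hC.subset_left_of_subset_union hU isClosed_closure.isOpen_compl
      (disjoint_compl_right.mono_left subset_closure) (fun z hz ↦ ?_) hne
    by_cases h : z ∈ closure U
    · refine Or.inl (by_contra fun h' ↦ Set.disjoint_left.1 hCK hz (hfr ?_))
      rw [hU.frontier_eq]
      exact ⟨h, h'⟩
    · exact Or.inr h
  have hγJ : ∀ t ∈ Ioo (0 : ℝ) 1, γ t ≠ a := fun t ht h ↦
    Set.disjoint_left.1 hGf (hJG ⟨t, ht, rfl⟩) (h ▸ ha)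
  have hIoo : ∀ z ∈ frontier G, z ≠ a → z ∈ g '' Ioo 0 1 := by
    intro z hz hza
    rw [← hgΓ] at hz
    obtain ⟨t, ht, rfl⟩ := hz
    refine ⟨t, ⟨ht.1.lt_of_ne ?_, ht.2.lt_of_ne ?_⟩, rfl⟩ <;> rintro rfl
    exacts [hza hg0, hza hg1]
  refine mem_accessiblePts_of_forall_exists hK hU hUc hUK hmax haU fun ε hε ↦ ?_
  by_cases h1 : γ 1 = a
  · have h0 : γ 0 ≠ a := fun h ↦ zero_ne_one (hinj (by simp) (by simp) (h.trans h1.symm))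
    have hmaps : MapsTo (fun t : ℝ ↦ 1 - t) (Icc 0 1) (Icc 0 1) := fun t ht ↦
      ⟨by linarith [ht.2], by linarith [ht.1]⟩
    have hrev : (fun t ↦ γ (1 - t)) '' Icc 0 1 = γ '' Icc 0 1 := by
      rw [← image_image γ (fun t ↦ 1 - t), image_const_sub_Icc]
      simp
    rw [hKdef, ← hrev]
    refine exists_isPreconnected_sdiff_subset_ball hg (hγ.comp (by fun_prop) hmaps) hg0 hg1 hga
      (by simpa using hIoo _ hγ0 h0) (fun t ht ↦ ?_) hε
    rcases ht.2.eq_or_lt with rfl | h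
    · simpa using h0
    · exact hγJ _ ⟨by linarith, by linarith [ht.1]⟩
  · refine exists_isPreconnected_sdiff_subset_ball hg hγ hg0 hg1 hga (hIoo _ hγ1 h1)
      (fun t ht ↦ ?_) hε
    rcases ht.2.eq_or_lt with rfl | h
    · exact h1
    · exact hγJ t ⟨ht.1, h⟩

end

theorem no_semiUnreachable_of_jordan
    (G : Set ℂ) (hG : IsJordanDomain G) :
    semiUnreachablePts G = ∅ := by
  obtain ⟨hGo, -, -, Γ, hΓ, rfl, -⟩ := hG
  refine Set.eq_empty_of_forall_notMem ?_
  rintro a ⟨ha, J, U, V, hJ, hU, hV, hUc, hVc, hUV, hGJ, hmem, -⟩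
  rcases hmem with h | h
  · exact h.2 (mem_accessiblePts_of_crosscut hGo hΓ hJ hU hV hUc.isPreconnected hUV hGJ ha h.1)
  · exact h.2 (mem_accessiblePts_of_crosscut hGo hΓ hJ hV hU hVc.isPreconnected hUV.symm
      (hGJ.trans (Set.union_comm U V)) ha h.1)
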